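/- Let N, K be positive integers with K ≤ N, let D ≥ 2 be an integer, let σ ∈ ℝ, let V be an N×D real matrix, and let C = σ·I_N + V·Vᵀ. Then max_{x ∈ S_K^N} xᵀCx exists and equals σ + max over φ ∈ (-π/2, π/2]^{D-1} of the sum of the K largest squared entries of the vector V·c(φ) ∈ ℝ^N. -/

import Mathlib

open Real Set Matrix

/-- `sparseUnit N K` is the set `S_K^N` of vectors in `ℝ^N` with Euclidean norm 1
and at most `K` nonzero entries. -/
def sparseUnit (N K : ℕ) : Set (Fin N → ℝ) :=
  {x | Real.sqrt (∑ i, x i ^ 2) = 1 ∧ {i | x i ≠ 0}.ncard ≤ K}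

/-- The hyperpolar vector `c(φ) ∈ ℝ^D` of angles `φ = (φ_1, …, φ_{D-1})`:
`c(φ)_k = cos φ_1 ⋯ cos φ_{k-1} · sin φ_k` for `k < D` and
`c(φ)_D = cos φ_1 ⋯ cos φ_{D-1}` (indices here are 0-based). -/
noncomputable def hyperpolar (D : ℕ) (φ : Fin (D - 1) → ℝ) : Fin D → ℝ :=
  fun k =>
    (∏ j ∈ Finset.univ.filter (fun j : Fin (D - 1) => (j : ℕ) < (k : ℕ)), Real.cos (φ j)) *
      (if h : (k : ℕ) < D - 1 then Real.sin (φ ⟨k, h⟩) else 1)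

theorem hyperpolar_cons_zero (n : ℕ) (a : ℝ) (φ : Fin n → ℝ) :
    hyperpolar (n + 2) (Fin.cons a φ) 0 = Real.sin a := by
  simp only [hyperpolar]
  rw [dif_pos (by simp)]
  have h : (Finset.univ.filter
      (fun j : Fin (n + 2 - 1) => (j : ℕ) < ((0 : Fin (n + 2)) : ℕ))) = ∅ := by simp
  rw [h, Finset.prod_empty, one_mul]
  rfl

theorem hyperpolar_cons_succ (n : ℕ) (a : ℝ) (φ : Fin n → ℝ) (k : Fin (n + 1)) :
    hyperpolar (n + 2) (Fin.cons a φ) k.succ = Real.cos a * hyperpolar (n + 1) φ k := by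
  simp only [hyperpolar]
  rw [← mul_assoc]
  congr 1
  · rw [Finset.prod_filter, Finset.prod_filter]
    change ∏ j : Fin (n + 1), _ = Real.cos a * ∏ j : Fin n, _
    rw [Fin.prod_univ_succ]
    simp
  · by_cases h : (k : ℕ) < n
    · rw [dif_pos (show (k : ℕ) < n + 1 - 1 by simpa using h),
        dif_pos (show (k.succ : ℕ) < n + 2 - 1 by simpa using h)]
      rfl
    · rw [dif_neg (show ¬ (k : ℕ) < n + 1 - 1 by simpa using h),
        dif_neg (show ¬ (k.succ : ℕ) < n + 2 - 1 by simpa using h)]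

theorem hyperpolar_one (φ : Fin 0 → ℝ) (k : Fin 1) : hyperpolar 1 φ k = 1 := by
  simp [hyperpolar]

theorem sum_sq_hyperpolar (n : ℕ) (φ : Fin n → ℝ) :
    ∑ k, hyperpolar (n + 1) φ k ^ 2 = 1 := by
  induction n with
  | zero => simp [hyperpolar_one]
  | succ n ih =>
    obtain ⟨a, ψ, rfl⟩ : ∃ (a : ℝ) (ψ : Fin n → ℝ), φ = Fin.cons a ψ :=
      ⟨φ 0, Fin.tail φ, (Fin.cons_self_tail φ).symm⟩
    rw [Fin.sum_univ_succ, hyperpolar_cons_zero]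
    simp only [hyperpolar_cons_succ, mul_pow]
    rw [← Finset.mul_sum, ih, mul_one, Real.sin_sq_add_cos_sq]

/-- Every unit vector is, up to sign, a hyperpolar vector with angles in `(-π/2, π/2]`. -/
theorem exists_eq_sign_mul_hyperpolar (n : ℕ) (u : Fin (n + 1) → ℝ) (hu : ∑ k, u k ^ 2 = 1) :
    ∃ φ : Fin n → ℝ, (∀ j, φ j ∈ Set.Ioc (-(π / 2)) (π / 2)) ∧
      ∃ ε : ℝ, ε ^ 2 = 1 ∧ ∀ k, u k = ε * hyperpolar (n + 1) φ k := by
  induction n with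
  | zero =>
    refine ⟨Fin.elim0, fun j => j.elim0, u 0, by simpa using hu, fun k => ?_⟩
    rw [hyperpolar_one, mul_one, Fin.fin_one_eq_zero k]
  | succ n ih =>
    have hpi := Real.pi_pos
    rw [Fin.sum_univ_succ] at hu
    set s := ∑ k : Fin (n + 1), u k.succ ^ 2 with hs
    have hs0 : 0 ≤ s := Finset.sum_nonneg fun _ _ => sq_nonneg _
    rcases hs0.eq_or_lt with h0 | hpos
    · have hz : ∀ k : Fin (n + 1), u k.succ = 0 := fun k => by
        have := (Finset.sum_eq_zero_iff_of_nonneg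
          (fun (i : Fin (n + 1)) _ => sq_nonneg (u i.succ))).1 h0.symm k (Finset.mem_univ k)
        exact pow_eq_zero_iff two_ne_zero |>.1 this
      refine ⟨Fin.cons (π / 2) (fun _ => 0), ?_, u 0, by linarith, ?_⟩
      · intro j
        refine Fin.cases ?_ (fun i => ?_) j
        · simp only [Fin.cons_zero]; constructor <;> linarith
        · simp only [Fin.cons_succ]; constructor <;> linarith
      · intro k
        refine Fin.cases ?_ (fun i => ?_) k
        · rw [hyperpolar_cons_zero]; simp
        · rw [hyperpolar_cons_succ, hz]; simp
    · have hr : 0 < √s := Real.sqrt_pos.2 hpos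
      have hr2 : √s ^ 2 = s := Real.sq_sqrt hs0
      obtain ⟨φ, hφ, ε, hε, h⟩ := ih (fun k => u k.succ / √s) (by
        simp only [div_pow]
        rw [← Finset.sum_div, hr2, ← hs, div_self hpos.ne'])
      have hsq : (ε * u 0) ^ 2 = 1 - s := by rw [mul_pow, hε]; linarith
      have hcos : Real.cos (Real.arcsin (ε * u 0)) = √s := by
        rw [Real.cos_arcsin, hsq]; congr 1; ring
      have hlt : -1 < ε * u 0 ∧ ε * u 0 < 1 :=
        abs_lt.1 ((sq_lt_one_iff_abs_lt_one _).1 (by linarith))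
      refine ⟨Fin.cons (Real.arcsin (ε * u 0)) φ, ?_, ε, hε, ?_⟩
      · intro j
        refine Fin.cases ?_ (fun i => ?_) j
        · exact ⟨Real.neg_pi_div_two_lt_arcsin.2 hlt.1, Real.arcsin_le_pi_div_two _⟩
        · exact hφ i
      · intro k
        refine Fin.cases ?_ (fun i => ?_) k
        · rw [hyperpolar_cons_zero, Real.sin_arcsin hlt.1.le hlt.2.le, ← mul_assoc, ← sq, hε,
            one_mul]
        · rw [hyperpolar_cons_succ, hcos, mul_left_comm, ← h i]
          field_simp

/-- The sum of the squared entries of `V u` over `I` attains its maximum over unit vectors `u` and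
`K`-element sets `I`. -/
theorem exists_max_sum_sq_mulVec {N K D : ℕ} (hKN : K ≤ N) (hD : 0 < D)
    (V : Matrix (Fin N) (Fin D) ℝ) :
    ∃ (u : Fin D → ℝ) (I : Finset (Fin N)), ∑ k, u k ^ 2 = 1 ∧ I.card = K ∧
      ∀ (w : Fin D → ℝ) (J : Finset (Fin N)), ∑ k, w k ^ 2 = 1 → J.card = K →
        ∑ i ∈ J, (V *ᵥ w) i ^ 2 ≤ ∑ i ∈ I, (V *ᵥ u) i ^ 2 := by
  have hcomp : IsCompact {u : Fin D → ℝ | ∑ k, u k ^ 2 = 1} := by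
    refine Metric.isCompact_of_isClosed_isBounded
      (isClosed_eq (by fun_prop) continuous_const) ?_
    refine (Metric.isBounded_closedBall (x := (0 : Fin D → ℝ)) (r := 1)).subset fun u hu => ?_
    rw [mem_closedBall_zero_iff, pi_norm_le_iff_of_nonneg zero_le_one]
    intro i
    rw [Real.norm_eq_abs, ← sq_le_one_iff_abs_le_one, ← show ∑ k, u k ^ 2 = 1 from hu]
    exact Finset.single_le_sum (f := fun k => u k ^ 2) (fun _ _ => sq_nonneg _)
      (Finset.mem_univ i)
  have hne : {u : Fin D → ℝ | ∑ k, u k ^ 2 = 1}.Nonempty :=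
    ⟨Pi.single ⟨0, hD⟩ 1, by simp [Pi.single_apply, ite_pow]⟩
  have hmax : ∀ I : Finset (Fin N), ∃ u : Fin D → ℝ, ∑ k, u k ^ 2 = 1 ∧
      ∀ w : Fin D → ℝ, ∑ k, w k ^ 2 = 1 →
        ∑ i ∈ I, (V *ᵥ w) i ^ 2 ≤ ∑ i ∈ I, (V *ᵥ u) i ^ 2 := fun I => by
    obtain ⟨u, hu, h⟩ := hcomp.exists_isMaxOn hne
      (f := fun u => ∑ i ∈ I, (V *ᵥ u) i ^ 2) (by
        simp only [Matrix.mulVec, dotProduct]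
        fun_prop)
    exact ⟨u, hu, fun w hw => h hw⟩
  choose u hu h using hmax
  obtain ⟨I, hI, hImax⟩ := Finset.exists_max_image
    (Finset.powersetCard K (Finset.univ : Finset (Fin N)))
    (fun I => ∑ i ∈ I, (V *ᵥ u I) i ^ 2)
    (Finset.powersetCard_nonempty.2 (by simpa using hKN))
  refine ⟨u I, I, hu I, (Finset.mem_powersetCard.1 hI).2, fun w J hw hJ => ?_⟩
  exact (h J w hw).trans (hImax J (Finset.mem_powersetCard.2 ⟨Finset.subset_univ _, hJ⟩))

theorem sum_sq_mulVec_smul {N D : ℕ} (V : Matrix (Fin N) (Fin D) ℝ) (I : Finset (Fin N))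
    (c : ℝ) (w : Fin D → ℝ) :
    ∑ i ∈ I, (V *ᵥ (c • w)) i ^ 2 = c ^ 2 * ∑ i ∈ I, (V *ᵥ w) i ^ 2 := by
  simp only [Matrix.mulVec_smul, Pi.smul_apply, smul_eq_mul, mul_pow, Finset.mul_sum]

/-- Homogeneous form of a bound for unit vectors. -/
theorem sum_sq_mulVec_le {N D : ℕ} (V : Matrix (Fin N) (Fin D) ℝ) (I : Finset (Fin N)) (M : ℝ)
    (hM : ∀ w : Fin D → ℝ, ∑ k, w k ^ 2 = 1 → ∑ i ∈ I, (V *ᵥ w) i ^ 2 ≤ M) (y : Fin D → ℝ)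
    (hy : 0 < ∑ k, y k ^ 2) :
    ∑ i ∈ I, (V *ᵥ y) i ^ 2 ≤ M * ∑ k, y k ^ 2 := by
  have hr : (√(∑ k, y k ^ 2))⁻¹ ^ 2 = (∑ k, y k ^ 2)⁻¹ := by
    rw [inv_pow, Real.sq_sqrt hy.le]
  have h := hM ((√(∑ k, y k ^ 2))⁻¹ • y) (by
    simp only [Pi.smul_apply, smul_eq_mul, mul_pow]
    rw [← Finset.mul_sum, hr, inv_mul_cancel₀ hy.ne'])
  rw [sum_sq_mulVec_smul, hr, inv_mul_le_iff₀ hy] at h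
  linarith

theorem dotProduct_smul_one_add_mul_transpose {N D : ℕ} (σ : ℝ) (V : Matrix (Fin N) (Fin D) ℝ)
    (x : Fin N → ℝ) :
    x ⬝ᵥ ((σ • (1 : Matrix (Fin N) (Fin N) ℝ) + V * V.transpose) *ᵥ x) =
      σ * ∑ i, x i ^ 2 + ∑ k, (x ᵥ* V) k ^ 2 := by
  rw [Matrix.add_mulVec, dotProduct_add, Matrix.smul_mulVec, Matrix.one_mulVec, dotProduct_smul,
    ← Matrix.mulVec_mulVec, Matrix.dotProduct_mulVec, Matrix.mulVec_transpose]
  simp only [dotProduct, smul_eq_mul, sq]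

theorem mem_sparseUnit {N K : ℕ} {x : Fin N → ℝ} :
    x ∈ sparseUnit N K ↔ ∑ i, x i ^ 2 = 1 ∧ {i | x i ≠ 0}.ncard ≤ K := by
  rw [sparseUnit, Set.mem_ofPred_eq, Real.sqrt_eq_one]

/-- A vector with at most `K` nonzero entries is supported in a `K`-element set. -/
theorem exists_card_eq_support_subset {N K : ℕ} (hKN : K ≤ N) {x : Fin N → ℝ}
    (hx : {i | x i ≠ 0}.ncard ≤ K) :
    ∃ I : Finset (Fin N), I.card = K ∧ ∀ i, i ∉ I → x i = 0 := by
  classical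
  obtain ⟨I, hI, hIK⟩ := Finset.exists_superset_card_eq
    (s := Finset.univ.filter fun i => x i ≠ 0) (n := K)
    (by rw [Set.ncard_eq_toFinset_card'] at hx; simpa using hx) (by simpa using hKN)
  exact ⟨I, hIK, fun i hi => by_contra fun h => hi (hI (by simpa using h))⟩

theorem sum_sq_vecMul_le {N D : ℕ} (V : Matrix (Fin N) (Fin D) ℝ) (I : Finset (Fin N)) (M : ℝ)
    (hM0 : 0 ≤ M)
    (hM : ∀ w : Fin D → ℝ, ∑ k, w k ^ 2 = 1 → ∑ i ∈ I, (V *ᵥ w) i ^ 2 ≤ M)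
    (x : Fin N → ℝ) (hx : ∑ i, x i ^ 2 = 1) (hxI : ∀ i, i ∉ I → x i = 0) :
    ∑ k, (x ᵥ* V) k ^ 2 ≤ M := by
  set s := ∑ k, (x ᵥ* V) k ^ 2 with hs
  rcases (show 0 ≤ s from Finset.sum_nonneg fun _ _ => sq_nonneg _).eq_or_lt with h0 | hpos
  · rwa [← h0]
  have hsum : s = ∑ i ∈ I, x i * (V *ᵥ (x ᵥ* V)) i := by
    rw [Finset.sum_subset (Finset.subset_univ I)
      (fun i _ hi => by rw [hxI i hi, zero_mul])]
    change s = x ⬝ᵥ (V *ᵥ (x ᵥ* V))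
    rw [Matrix.dotProduct_mulVec, hs]
    simp only [dotProduct, sq]
  have hxs : ∑ i ∈ I, x i ^ 2 ≤ 1 := hx ▸
    Finset.sum_le_sum_of_subset_of_nonneg (Finset.subset_univ I) fun _ _ _ => sq_nonneg _
  have hcs : s ^ 2 ≤ (∑ i ∈ I, x i ^ 2) * ∑ i ∈ I, (V *ᵥ (x ᵥ* V)) i ^ 2 := by
    rw [hsum]; exact Finset.sum_mul_sq_le_sq_mul_sq _ _ _
  have hb := sum_sq_mulVec_le V I M hM (x ᵥ* V) hpos
  have : s ^ 2 ≤ M * s := hcs.trans ((mul_le_of_le_one_left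
    (Finset.sum_nonneg fun _ _ => sq_nonneg _) hxs).trans hb)
  nlinarith

/-- The normalized restriction of `V u` to `I` is a unit vector `x` with `‖Vᵀ x‖²` at least
the sum of the squared entries of `V u` over `I`. -/
theorem exists_sum_sq_le_vecMul {N D : ℕ} (V : Matrix (Fin N) (Fin D) ℝ) (I : Finset (Fin N))
    (hI : I.Nonempty) (u : Fin D → ℝ) (hu : ∑ k, u k ^ 2 = 1) :
    ∃ x : Fin N → ℝ, ∑ i, x i ^ 2 = 1 ∧ (∀ i, i ∉ I → x i = 0) ∧
      ∑ i ∈ I, (V *ᵥ u) i ^ 2 ≤ ∑ k, (x ᵥ* V) k ^ 2 := by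
  classical
  set M := ∑ i ∈ I, (V *ᵥ u) i ^ 2 with hM
  rcases (show 0 ≤ M from Finset.sum_nonneg fun _ _ => sq_nonneg _).eq_or_lt with h0 | hpos
  · obtain ⟨j, hj⟩ := hI
    refine ⟨Pi.single j 1, by simp [Pi.single_apply, ite_pow], fun i hi => ?_, ?_⟩
    · exact Pi.single_eq_of_ne (fun h : i = j => hi (h ▸ hj)) _
    · rw [← h0]; exact Finset.sum_nonneg fun _ _ => sq_nonneg _
  · have hr2 : √M ^ 2 = M := Real.sq_sqrt hpos.le
    have hr : 0 < √M := Real.sqrt_pos.2 hpos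
    set x : Fin N → ℝ := fun i => if i ∈ I then (V *ᵥ u) i / √M else 0 with hx
    refine ⟨x, ?_, fun i hi => by simp [hx, hi], ?_⟩
    · simp only [hx, ite_pow, div_pow, hr2]
      rw [zero_pow two_ne_zero, Finset.sum_ite_mem, Finset.univ_inter, ← Finset.sum_div, ← hM,
        div_self hpos.ne']
    · have hdot : ∑ k, (x ᵥ* V) k * u k = √M := by
        change (x ᵥ* V) ⬝ᵥ u = √M
        rw [← Matrix.dotProduct_mulVec, dotProduct]
        simp only [hx, ite_mul, zero_mul]
        rw [Finset.sum_ite_mem, Finset.univ_inter]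
        simp only [div_mul_eq_mul_div, ← sq]
        rw [← Finset.sum_div, ← hM, Real.div_sqrt]
      have hcs := Finset.sum_mul_sq_le_sq_mul_sq Finset.univ (x ᵥ* V) u
      rwa [hdot, hu, hr2, mul_one] at hcs

theorem stmt15 (N K : ℕ) (hN : 0 < N) (hK : 0 < K) (hKN : K ≤ N)
    (D : ℕ) (hD : 2 ≤ D) (σ : ℝ)
    (V : Matrix (Fin N) (Fin D) ℝ)
    (C : Matrix (Fin N) (Fin N) ℝ)
    (hC : C = σ • (1 : Matrix (Fin N) (Fin N) ℝ) + V * V.transpose) :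
    ∃ M : ℝ,
      IsGreatest ((fun x => x ⬝ᵥ (C *ᵥ x)) '' sparseUnit N K) (σ + M) ∧
      IsGreatest
        {m : ℝ | ∃ φ : Fin (D - 1) → ℝ,
          (∀ j, φ j ∈ Set.Ioc (-(π / 2)) (π / 2)) ∧
          IsGreatest ((fun I : Finset (Fin N) =>
              ∑ i ∈ I, ((V *ᵥ hyperpolar D φ) i) ^ 2) ''
            {I : Finset (Fin N) | I.card = K}) m} M := by
  subst hC
  obtain ⟨n, rfl⟩ : ∃ n, D = n + 1 := ⟨D - 1, by omega⟩
  obtain ⟨u, I, hu, hI, hmax⟩ := exists_max_sum_sq_mulVec hKN (Nat.succ_pos n) V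
  have hM0 : 0 ≤ ∑ i ∈ I, (V *ᵥ u) i ^ 2 := Finset.sum_nonneg fun _ _ => sq_nonneg _
  have hle : ∀ x ∈ sparseUnit N K,
      ∑ k, (x ᵥ* V) k ^ 2 ≤ ∑ i ∈ I, (V *ᵥ u) i ^ 2 := fun x hx => by
    obtain ⟨hx1, hxK⟩ := mem_sparseUnit.1 hx
    obtain ⟨J, hJ, hxJ⟩ := exists_card_eq_support_subset hKN hxK
    exact sum_sq_vecMul_le V J _ hM0 (fun w hw => hmax w J hw hJ) x hx1 hxJ
  refine ⟨∑ i ∈ I, (V *ᵥ u) i ^ 2, ⟨?_, ?_⟩, ?_, ?_⟩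
  · obtain ⟨x, hx1, hxI, hx⟩ := exists_sum_sq_le_vecMul V I
      (Finset.card_pos.1 (by omega)) u hu
    have hxS : x ∈ sparseUnit N K := by
      refine mem_sparseUnit.2 ⟨hx1, ?_⟩
      rw [← hI, ← Set.ncard_coe_finset]
      exact Set.ncard_le_ncard (fun i hi => by_contra fun h => hi (hxI i h)) I.finite_toSet
    refine ⟨x, hxS, ?_⟩
    simp only [dotProduct_smul_one_add_mul_transpose, hx1, mul_one]
    rw [le_antisymm (hle x hxS) hx]
  · rintro _ ⟨x, hx, rfl⟩
    simp only [dotProduct_smul_one_add_mul_transpose, (mem_sparseUnit.1 hx).1, mul_one]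
    linarith [hle x hx]
  · obtain ⟨φ, hφ, ε, hε, h⟩ := exists_eq_sign_mul_hyperpolar n u hu
    have hu' : u = ε • hyperpolar (n + 1) φ := funext h
    refine ⟨φ, hφ, ⟨I, hI, ?_⟩, ?_⟩
    · simp only [hu', sum_sq_mulVec_smul, hε, one_mul]
    · rintro _ ⟨J, hJ, rfl⟩
      exact hmax _ J (sum_sq_hyperpolar n φ) hJ
  · rintro m ⟨φ, -, ⟨J, hJ, rfl⟩, -⟩
    exact hmax _ J (sum_sq_hyperpolar n φ) hJ
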